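/- arXiv:1005.4576 — 4 statements merged into one kernel-verified Lean document; each statement's English description precedes it below -/
import Mathlib

section
/- Let E be a finite-dimensional vector space over a field K equipped with an arbitrary bilinear product (x,y) ↦ xy, and let ψ: E⊗E → E be the linear map with xy + ψ(x⊗y) = 0 for all x,y ∈ E. Let d: T(E*) → T(E*) be any degree-1 antiderivation of the tensor algebra over the dual space E* (i.e., d(E*^{⊗n}) ⊆ E*^{⊗(n+1)} and d(ab) = d(a)b + (−1)ᵖ a d(b) for a ∈ E*^{⊗p}) whose restriction to E* equals the transpose ψᵗ: E* → E*⊗E*. Then d∘d = 0 if and only if the product on E is associative, i.e., (xy)z = x(yz) for all x,y,z ∈ E. -/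
/-!
STATEMENT 2: Let `E` be a finite-dimensional vector space over a field `K` equipped with
an arbitrary bilinear product `(x,y) ↦ xy`, and `ψ : E⊗E → E` the linear map with
`xy + ψ(x⊗y) = 0`.  Let `d : T(E*) → T(E*)` be any degree-1 antiderivation of the tensor
algebra over `E*` whose restriction to `E*` is the transpose `ψᵗ : E* → E*⊗E*`.  Then
`d∘d = 0` iff the product is associative.

Encodings.  The grading of `T(E*)` is by the submodule powers `(E*)^⊗n`; the transpose
`ψᵗ` is `(dualDistribEquiv)⁻¹ ∘ (dualMap ψ) : E* → (E⊗E)* ≅ E*⊗E*` (using finite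
dimensionality), and its value is regarded inside the degree-2 component of `T(E*)` via
the canonical isomorphism `μ : E*⊗E* → T²(E*)`, `α⊗β ↦ α·β`.
-/

noncomputable section

open TensorAlgebra TensorProduct

variable (K E : Type) [Field K] [AddCommGroup E] [Module K E]

/-- The tensor algebra `T(E*)` over the dual space. -/
abbrev TD := TensorAlgebra K (Module.Dual K E)

/-- The canonical inclusion `E* → T(E*)`. -/
abbrev ιD : Module.Dual K E →ₗ[K] TD K E := TensorAlgebra.ι K

/-- The degree-`n` component `E*^{⊗n}` of `T(E*)`. -/
def TDdeg (n : ℕ) : Submodule K (TD K E) := LinearMap.range (ιD K E) ^ n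

/-- The canonical map `E* ⊗ E* → T(E*)`, an isomorphism onto the degree-2 component. -/
def mulDD : Module.Dual K E ⊗[K] Module.Dual K E →ₗ[K] TD K E :=
  LinearMap.mul' K (TD K E) ∘ₗ TensorProduct.map (ιD K E) (ιD K E)

variable {K E}

section SumComm

variable {I M : Type} [Fintype I] [AddCommMonoid M]

theorem sum_rotate_inner_first (f : I → I → I → I → M) :
    ∑ i, ∑ r, ∑ p, ∑ q, f i r p q = ∑ p, ∑ q, ∑ r, ∑ i, f i r p q := by
  rw [Finset.sum_congr rfl fun i _ => Finset.sum_comm_cycle.symm, ← Finset.sum_comm_cycle]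
  exact Finset.sum_congr rfl fun p _ => Finset.sum_congr rfl fun q _ => Finset.sum_comm

theorem sum_rotate_inner_second (f : I → I → I → I → M) :
    ∑ p, ∑ j, ∑ q, ∑ r, f p j q r = ∑ p, ∑ q, ∑ r, ∑ j, f p j q r := by
  refine Finset.sum_congr rfl fun p _ => ?_
  rw [Finset.sum_comm]
  exact Finset.sum_congr rfl fun q _ => Finset.sum_comm

end SumComm

section FiniteBasis

variable {I : Type} [Fintype I] [DecidableEq I] (b : Module.Basis I K E)

theorem dualDistribEquiv_symm_apply_basis [FiniteDimensional K E]
    (f : Module.Dual K (E ⊗[K] E)) :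
    (TensorProduct.dualDistribEquiv K E E).symm f =
      ∑ i, ∑ j, f (b i ⊗ₜ b j) • b.coord i ⊗ₜ[K] b.coord j := by
  rw [LinearEquiv.symm_apply_eq]
  change f = TensorProduct.dualDistrib K E E _
  refine (b.tensorProduct b).ext fun ⟨p, q⟩ => ?_
  simp [Finsupp.single_apply]

theorem mulDD_dualDistribEquiv_symm [FiniteDimensional K E]
    (mul : E →ₗ[K] E →ₗ[K] E) (α : Module.Dual K E) :
    mulDD K E ((TensorProduct.dualDistribEquiv K E E).symm
        (LinearMap.dualMap (-(TensorProduct.lift mul)) α)) =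
      -∑ i, ∑ j, α (mul (b i) (b j)) • (ιD K E (b.coord i) * ιD K E (b.coord j)) := by
  rw [dualDistribEquiv_symm_apply_basis b]
  simp [mulDD]

end FiniteBasis

/-- The algebra morphism from `T(E*)` to matrices whose `(0, 3)` entry evaluates a
degree-3 tensor at `x ⊗ y ⊗ z`. -/
def evalMatrix (x y z : E) : TD K E →ₐ[K] Matrix (Fin 4) (Fin 4) K :=
  TensorAlgebra.lift K
    ((Module.Dual.eval K E x).smulRight (Matrix.single 0 1 1) +
      (Module.Dual.eval K E y).smulRight (Matrix.single 1 2 1) +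
      (Module.Dual.eval K E z).smulRight (Matrix.single 2 3 1))

theorem evalMatrix_mul_mul (x y z : E) (α β γ : Module.Dual K E) :
    evalMatrix x y z (ιD K E α * ιD K E β * ιD K E γ) 0 3 = α x * β y * γ z := by
  simp [evalMatrix, Matrix.mul_apply, Matrix.single_apply]

theorem ιD_mem_TDdeg_one (α : Module.Dual K E) : ιD K E α ∈ TDdeg K E 1 := by
  rw [TDdeg, pow_one]
  exact LinearMap.mem_range_self _ α

theorem one_mem_TDdeg_zero : (1 : TD K E) ∈ TDdeg K E 0 := by
  rw [TDdeg, pow_zero]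
  exact Submodule.one_le.mp le_rfl

section Antiderivation

variable {d : TD K E →ₗ[K] TD K E}
  (hleibniz : ∀ (p : ℕ) (a b : TD K E), a ∈ TDdeg K E p →
    d (a * b) = d a * b + ((-1 : K) ^ p) • (a * d b))

include hleibniz

theorem antiderivation_one : d 1 = 0 := by
  simpa using hleibniz 0 1 1 one_mem_TDdeg_zero

theorem antiderivation_ι_mul (α : Module.Dual K E) (a : TD K E) :
    d (ιD K E α * a) = d (ιD K E α) * a - ιD K E α * d a := by
  simpa [sub_eq_add_neg] using hleibniz 1 (ιD K E α) a (ιD_mem_TDdeg_one α)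

theorem antiderivation_sq_eq_zero
    (hdeg : ∀ (n : ℕ), ∀ a ∈ TDdeg K E n, d a ∈ TDdeg K E (n + 1))
    (h : ∀ α, d (d (ιD K E α)) = 0) : d ∘ₗ d = 0 := by
  have key : ∀ a c : TD K E, d (d c) = 0 → d (d (a * c)) = 0 := by
    intro a
    induction a using TensorAlgebra.induction with
    | algebraMap r =>
      intro c hc
      rw [← Algebra.smul_def, map_smul, map_smul, hc, smul_zero]
    | ι α =>
      intro c hc
      rw [antiderivation_ι_mul hleibniz, map_sub,
        hleibniz 2 _ c (hdeg 1 _ (ιD_mem_TDdeg_one α)), antiderivation_ι_mul hleibniz, h, hc]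
      simp
    | mul a a' ha ha' =>
      intro c hc
      rw [mul_assoc]
      exact ha _ (ha' _ hc)
    | add a a' ha ha' =>
      intro c hc
      rw [add_mul, map_add, map_add, ha _ hc, ha' _ hc, add_zero]
  ext a
  simpa using key a 1 (by rw [antiderivation_one hleibniz, map_zero])

/-- The square of the antiderivation on `E*` is the transpose of the associator. -/
theorem antiderivation_sq_ι {I : Type} [Fintype I] (b : Module.Basis I K E)
    (mul : E →ₗ[K] E →ₗ[K] E)
    (hd : ∀ α, d (ιD K E α) =
      -∑ i, ∑ j, α (mul (b i) (b j)) • (ιD K E (b.coord i) * ιD K E (b.coord j)))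
    (α : Module.Dual K E) :
    d (d (ιD K E α)) =
      ∑ p, ∑ q, ∑ r, α (mul (mul (b p) (b q)) (b r) - mul (b p) (mul (b q) (b r))) •
        (ιD K E (b.coord p) * ιD K E (b.coord q) * ιD K E (b.coord r)) := by
  have hleft (p q r : I) : α (mul (mul (b p) (b q)) (b r)) =
      ∑ i, α (mul (b i) (b r)) * b.coord i (mul (b p) (b q)) := by
    conv_lhs => rw [← b.sum_repr (mul (b p) (b q))]
    simp only [map_sum, map_smul, LinearMap.sum_apply, LinearMap.smul_apply, smul_eq_mul,
      Module.Basis.coord_apply, mul_comm]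
  have hright (p q r : I) : α (mul (b p) (mul (b q) (b r))) =
      ∑ j, α (mul (b p) (b j)) * b.coord j (mul (b q) (b r)) := by
    conv_lhs => rw [← b.sum_repr (mul (b q) (b r))]
    simp only [map_sum, map_smul, smul_eq_mul, Module.Basis.coord_apply, mul_comm]
  have hsq : d (d (ιD K E α)) =
      (∑ i, ∑ r, ∑ p, ∑ q, (α (mul (b i) (b r)) * b.coord i (mul (b p) (b q))) •
        (ιD K E (b.coord p) * ιD K E (b.coord q) * ιD K E (b.coord r))) -
      ∑ p, ∑ j, ∑ q, ∑ r, (α (mul (b p) (b j)) * b.coord j (mul (b q) (b r))) •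
        (ιD K E (b.coord p) * ιD K E (b.coord q) * ιD K E (b.coord r)) := by
    rw [hd α]
    simp only [map_neg, map_sum, map_smul, antiderivation_ι_mul hleibniz]
    simp only [hd (b.coord _), neg_mul, mul_neg, Finset.sum_mul, Finset.mul_sum,
      smul_mul_assoc, mul_smul_comm, smul_sub, smul_neg, Finset.smul_sum, smul_smul,
      Finset.sum_sub_distrib, Finset.sum_neg_distrib, mul_assoc]
    abel
  rw [hsq]
  simp only [map_sub, sub_smul, Finset.sum_sub_distrib, hleft, hright, Finset.sum_smul]
  rw [sum_rotate_inner_first fun i r p q =>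
      (α (mul (b i) (b r)) * b.coord i (mul (b p) (b q))) •
        (ιD K E (b.coord p) * ιD K E (b.coord q) * ιD K E (b.coord r)),
    sum_rotate_inner_second fun p j q r =>
      (α (mul (b p) (b j)) * b.coord j (mul (b q) (b r))) •
        (ιD K E (b.coord p) * ιD K E (b.coord q) * ιD K E (b.coord r))]

end Antiderivation

variable (K E)

theorem stmt_2 [FiniteDimensional K E]
    (mul : E →ₗ[K] E →ₗ[K] E)   -- the bilinear product `(x,y) ↦ xy`
    (d : TD K E →ₗ[K] TD K E)
    -- `d` has degree 1
    (hdeg : ∀ (n : ℕ), ∀ a ∈ TDdeg K E n, d a ∈ TDdeg K E (n + 1))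
    -- `d` is an antiderivation
    (hleibniz : ∀ (p : ℕ) (a b : TD K E), a ∈ TDdeg K E p →
      d (a * b) = d a * b + ((-1 : K) ^ p) • (a * d b))
    -- the restriction of `d` to `E*` equals the transpose `ψᵗ : E* → E*⊗E*` of
    -- `ψ = −(the product) : E⊗E → E`
    (hrestrict : ∀ α : Module.Dual K E,
      d (ιD K E α) =
        mulDD K E ((TensorProduct.dualDistribEquiv K E E).symm
          (LinearMap.dualMap (-(TensorProduct.lift mul)) α))) :
    d ∘ₗ d = 0 ↔ ∀ x y z : E, mul (mul x y) z = mul x (mul y z) := by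
  classical
  let b := Module.finBasis K E
  have hd (α : Module.Dual K E) := (hrestrict α).trans (mulDD_dualDistribEquiv_symm b mul α)
  have hsq := antiderivation_sq_ι hleibniz b mul hd
  constructor
  · intro h
    have hassoc : mul.compr₂ mul =
        LinearMap.lcomp K (E →ₗ[K] E) mul ∘ₗ LinearMap.llcomp K E E E ∘ₗ mul := by
      refine b.ext fun p => b.ext fun q => b.ext fun r => ?_
      change mul (mul (b p) (b q)) (b r) = mul (b p) (mul (b q) (b r))
      refine sub_eq_zero.mp ((Module.forall_dual_apply_eq_zero_iff K _).mp fun α => ?_)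
      have h0 : d (d (ιD K E α)) = 0 := LinearMap.congr_fun h _
      have hentry := congrArg (fun a => evalMatrix (b p) (b q) (b r) a 0 3) ((hsq α).symm.trans h0)
      simpa only [map_sum, map_smul, Matrix.sum_apply, Matrix.smul_apply, evalMatrix_mul_mul,
        Module.Basis.coord_apply, Module.Basis.repr_self, Finsupp.single_apply, smul_eq_mul,
        map_zero, Matrix.zero_apply, mul_ite, ite_mul, mul_one, one_mul, mul_zero, zero_mul,
        Finset.sum_ite_eq, Finset.sum_ite_eq', Finset.mem_univ, if_true,
        Finset.sum_const_zero] using hentry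
    intro x y z
    exact LinearMap.congr_fun (LinearMap.congr_fun (LinearMap.congr_fun hassoc x) y) z
  · intro h
    refine antiderivation_sq_eq_zero hleibniz hdeg fun α => ?_
    simp [hsq α, h]

end
end

section
/- Let E be a finite-dimensional vector space over a field K equipped with a bilinear product (x,y) ↦ xy. Let 𝔄 = T(E)/(P) where P = span{x⊗y − xy : x,y ∈ E} ⊆ E ⊕ E⊗E, equipped with the filtration induced from Fⁿ(T(E)) = ⊕_{m≤n} E^{⊗m}, and let gr(𝔄) be the associated graded algebra. Let A = T(E)/(E⊗E) = K·1 ⊕ E be the trivial quadratic algebra (in which the product of any two elements of E is zero). Then the canonical surjective homomorphism of graded algebras can: A → gr(𝔄) is an isomorphism if and only if the product on E is associative. -/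
/-!
STATEMENT 3: Let `E` be a finite-dimensional vector space over a field `K` equipped with a
bilinear product `(x,y) ↦ xy`.  Let `𝔄 = T(E)/(P)` where `P = span{x⊗y − xy}`, with the
filtration induced from `Fⁿ(T(E)) = ⊕_{m≤n} E^{⊗m}`, and let `A = T(E)/(E⊗E) = K·1 ⊕ E` be
the trivial quadratic algebra.  Then the canonical surjective graded algebra homomorphism
`can : A → gr(𝔄)` is an isomorphism iff the product is associative.

Encoding of "can is an isomorphism": `A = T(E)/(R)` with `R = E⊗E`, graded by
`Aₙ = Tₙ/((R) ∩ Tₙ)` with `Tₙ = E^{⊗n}`, and `can` is the degreewise surjection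
`Tₙ/((R) ∩ Tₙ) → Fⁿ(𝔄)/Fⁿ⁻¹(𝔄) = Fⁿ(T(E))/(Fⁿ⁻¹(T(E)) + (P) ∩ Fⁿ(T(E)))` induced by
`Tₙ ⊆ Fⁿ(T(E))`.  It is an isomorphism of graded algebras precisely when
`Tₙ ⊓ ((P) ⊔ Fⁿ⁻¹(T(E))) = (R) ⊓ Tₙ` for every `n`, which is the formulation used below.
-/

noncomputable section

open TensorAlgebra TensorProduct

variable (K E : Type) [Field K] [AddCommGroup E] [Module K E]

/-- The tensor algebra `T(E)`. -/
abbrev T := TensorAlgebra K E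

/-- The canonical inclusion `E → T(E)`. -/
abbrev ιE : E →ₗ[K] T K E := TensorAlgebra.ι K

/-- The degree-`n` homogeneous component `E^{⊗n} ⊆ T(E)`. -/
def Tdeg (n : ℕ) : Submodule K (T K E) := LinearMap.range (ιE K E) ^ n

/-- The filtration `Fⁿ(T(E)) = ⊕_{m ≤ n} E^{⊗m}` of the tensor algebra. -/
def FT : ℕ → Submodule K (T K E)
  | 0 => Tdeg K E 0
  | n + 1 => FT n ⊔ Tdeg K E (n + 1)

/-- `F^{n-1}(T(E))`, with the convention `F^{-1} = 0`. -/
def FTpred : ℕ → Submodule K (T K E)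
  | 0 => ⊥
  | n + 1 => FT K E n

/-- The two-sided ideal of `T(E)` generated by a subset `S`, as a `K`-submodule. -/
def idl (S : Set (T K E)) : Submodule K (T K E) :=
  Submodule.span K {z | ∃ a b : T K E, ∃ p ∈ S, z = a * p * b}

/-- The Poincaré–Birkhoff–Witt property for `𝔄 = T(E)/(P)` with quadratic part
`A = T(E)/(R)`: the canonical surjection `can : A → gr(𝔄)` is an isomorphism of graded
algebras, expressed degreewise (see the discussion above). -/
def PBWproperty (P R : Set (T K E)) : Prop :=
  ∀ n : ℕ, Tdeg K E n ⊓ (idl K E P ⊔ FTpred K E n) = idl K E R ⊓ Tdeg K E n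

/-- The action of a vector `x` on `K ⊕ E` by left multiplication, where `K ⊕ E` is the algebra
obtained from `E` by adjoining a unit: `(c, e) ↦ (0, c x + x e)`. -/
def leftMulUnitization (mul : E →ₗ[K] E →ₗ[K] E) : E →ₗ[K] Module.End K (K × E) :=
  LinearMap.mk₂ K (fun x v => (0, v.1 • x + mul x v.2))
    (fun x y v => by ext <;> simp; abel)
    (fun c x v => by ext <;> simp [smul_comm v.1 c])
    (fun x v w => by ext <;> simp [add_smul]; abel)
    (fun c x v => by ext <;> simp [mul_smul])

variable {K E}

theorem leftMulUnitization_apply (mul : E →ₗ[K] E →ₗ[K] E) (x : E) (v : K × E) :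
    leftMulUnitization K E mul x v = (0, v.1 • x + mul x v.2) := rfl

theorem mul_mul_mem_idl {S : Set (T K E)} {p : T K E} (hp : p ∈ S) (a b : T K E) :
    a * p * b ∈ idl K E S :=
  Submodule.subset_span ⟨a, b, p, hp, rfl⟩

/-- An algebra homomorphism vanishing on `S` vanishes on the two-sided ideal generated
by `S`. -/
theorem map_eq_zero_of_mem_idl {B : Type*} [Ring B] [Algebra K B] (f : T K E →ₐ[K] B)
    {S : Set (T K E)} (hS : ∀ p ∈ S, f p = 0) {t : T K E} (ht : t ∈ idl K E S) : f t = 0 := by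
  have h : idl K E S ≤ LinearMap.ker f.toLinearMap := by
    refine Submodule.span_le.2 ?_
    rintro _ ⟨a, b, p, hp, rfl⟩
    simp [hS p hp]
  exact h ht

/-- For an associative product, `K ⊕ E` embeds in `T(E)/(x ⊗ y - xy)`. -/
theorem eq_zero_of_algebraMap_add_ι_mem_idl (mul : E →ₗ[K] E →ₗ[K] E)
    (hmul : ∀ x y z : E, mul (mul x y) z = mul x (mul y z)) {c : K} {x : E}
    (h : algebraMap K (T K E) c + ιE K E x ∈ idl K E (Set.range fun p : E × E =>
      ιE K E p.1 * ιE K E p.2 - ιE K E (mul p.1 p.2))) : c = 0 ∧ x = 0 := by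
  have h0 := map_eq_zero_of_mem_idl (TensorAlgebra.lift K (leftMulUnitization K E mul))
    (by
      rintro _ ⟨⟨y, z⟩, rfl⟩
      refine LinearMap.ext fun v => ?_
      simp [leftMulUnitization_apply, hmul]) h
  have h1 := LinearMap.congr_fun h0 ((1, 0) : K × E)
  simpa [leftMulUnitization_apply, Module.algebraMap_end_apply, Prod.ext_iff] using h1

theorem eq_zero_of_algebraMap_add_ι_mem_idl_range_mul {c : K} {x : E}
    (h : algebraMap K (T K E) c + ιE K E x ∈ idl K E (Set.range fun p : E × E =>
      ιE K E p.1 * ιE K E p.2)) : c = 0 ∧ x = 0 :=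
  eq_zero_of_algebraMap_add_ι_mem_idl (0 : E →ₗ[K] E →ₗ[K] E) (by simp) (by simpa using h)

theorem Tdeg_le_FT (n : ℕ) : Tdeg K E n ≤ FT K E n := by
  cases n with
  | zero => exact le_rfl
  | succ n => exact le_sup_right

theorem mem_Tdeg_zero {t : T K E} : t ∈ Tdeg K E 0 ↔ ∃ c, algebraMap K (T K E) c = t := by
  rw [Tdeg, pow_zero, Submodule.mem_one]

theorem mem_Tdeg_one {t : T K E} : t ∈ Tdeg K E 1 ↔ ∃ x, ιE K E x = t := by
  rw [Tdeg, pow_one, LinearMap.mem_range]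

/-- To bound `E^{⊗(n+2)}` it suffices to treat the elements `a ⊗ x ⊗ y` with
`a ∈ E^{⊗n}`. -/
theorem Tdeg_add_two_le {n : ℕ} {N : Submodule K (T K E)}
    (h : ∀ a ∈ Tdeg K E n, ∀ x y : E, a * (ιE K E x * ιE K E y) ∈ N) :
    Tdeg K E (n + 2) ≤ N := by
  rw [Tdeg, pow_add, pow_two, Submodule.mul_le]
  intro a ha b hb
  induction hb using Submodule.mul_induction_on' with
  | mem_mul_mem u hu v hv =>
    obtain ⟨x, rfl⟩ := hu
    obtain ⟨y, rfl⟩ := hv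
    exact h a ha x y
  | add u _ v _ hu hv => rw [mul_add]; exact N.add_mem hu hv

theorem Tdeg_add_two_le_idl_range_mul (n : ℕ) :
    Tdeg K E (n + 2) ≤ idl K E (Set.range fun p : E × E => ιE K E p.1 * ιE K E p.2) :=
  Tdeg_add_two_le fun a _ x y => by
    simpa using mul_mul_mem_idl (Set.mem_range_self (x, y)) a 1

theorem Tdeg_add_two_le_idl_sup_FT (mul : E →ₗ[K] E →ₗ[K] E) (n : ℕ) :
    Tdeg K E (n + 2) ≤ idl K E (Set.range fun p : E × E =>
      ιE K E p.1 * ιE K E p.2 - ιE K E (mul p.1 p.2)) ⊔ FT K E (n + 1) := by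
  refine Tdeg_add_two_le fun a ha x y => ?_
  rw [← sub_add_cancel (a * (ιE K E x * ιE K E y)) (a * ιE K E (mul x y))]
  refine Submodule.add_mem_sup ?_ (Tdeg_le_FT _ ?_)
  · rw [← mul_sub]
    simpa only [mul_one] using mul_mul_mem_idl (S := Set.range fun p : E × E =>
      ιE K E p.1 * ιE K E p.2 - ιE K E (mul p.1 p.2)) (Set.mem_range_self (x, y)) a 1
  · rw [Tdeg, pow_succ]
    exact Submodule.mul_mem_mul ha (LinearMap.mem_range_self _ _)

/-- Associators of the product lie in the ideal generated by the `x ⊗ y - xy`. -/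
theorem ι_associator_mem_idl (mul : E →ₗ[K] E →ₗ[K] E) (x y z : E) :
    ιE K E (mul (mul x y) z - mul x (mul y z)) ∈ idl K E (Set.range fun p : E × E =>
      ιE K E p.1 * ιE K E p.2 - ιE K E (mul p.1 p.2)) := by
  have key (a b : T K E) (u v : E) := mul_mul_mem_idl (S := Set.range fun p : E × E =>
    ιE K E p.1 * ιE K E p.2 - ιE K E (mul p.1 p.2)) (Set.mem_range_self (u, v)) a b
  convert Submodule.sub_mem _
    (Submodule.add_mem _ (key (ιE K E x) 1 y z) (key 1 1 x (mul y z)))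
    (Submodule.add_mem _ (key 1 (ιE K E z) x y) (key 1 1 (mul x y) z)) using 1
  rw [map_sub]
  noncomm_ring

variable (K E)

theorem stmt_3 [FiniteDimensional K E]
    (mul : E →ₗ[K] E →ₗ[K] E)   -- the bilinear product `(x,y) ↦ xy`
    -- the space of relations of `𝔄`: `P = span{x⊗y − xy | x, y ∈ E}`
    (P : Set (T K E))
    (hP : P = Set.range fun p : E × E =>
      ιE K E p.1 * ιE K E p.2 - ιE K E (mul p.1 p.2))
    -- the space of relations of the trivial quadratic algebra `A = K·1 ⊕ E`: `R = E⊗E`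
    (R : Set (T K E))
    (hR : R = Set.range fun p : E × E => ιE K E p.1 * ιE K E p.2) :
    PBWproperty K E P R ↔
      ∀ x y z : E, mul (mul x y) z = mul x (mul y z) := by
  subst hP hR
  constructor
  · intro h x y z
    have hmem := (h 1).le ⟨mem_Tdeg_one.2 ⟨_, rfl⟩,
      Submodule.mem_sup_left (ι_associator_mem_idl mul x y z)⟩
    refine sub_eq_zero.1 (eq_zero_of_algebraMap_add_ι_mem_idl_range_mul (c := (0 : K)) ?_).2
    rw [map_zero, zero_add]
    exact hmem.1
  · intro hmul n
    match n with
    | 0 =>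
      refine le_antisymm ?_ ?_
      · rintro t ⟨ht, hmem⟩
        obtain ⟨c, rfl⟩ := mem_Tdeg_zero.1 ht
        have hc := (eq_zero_of_algebraMap_add_ι_mem_idl mul hmul (c := c) (x := 0)
          (by simpa [FTpred] using hmem)).1
        simp [hc]
      · rintro t ⟨hmem, ht⟩
        obtain ⟨c, rfl⟩ := mem_Tdeg_zero.1 ht
        have hc := (eq_zero_of_algebraMap_add_ι_mem_idl_range_mul (c := c) (x := (0 : E))
          (by simpa using hmem)).1
        simp [hc]
    | 1 =>
      refine le_antisymm ?_ ?_
      · rintro t ⟨ht, hmem⟩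
        obtain ⟨x, rfl⟩ := mem_Tdeg_one.1 ht
        obtain ⟨p, hp, s, hs, hps⟩ := Submodule.mem_sup.1 hmem
        obtain ⟨c, rfl⟩ := mem_Tdeg_zero.1 hs
        have hx := (eq_zero_of_algebraMap_add_ι_mem_idl mul hmul (c := -c) (x := x)
          (by rw [← hps, map_neg]; simpa using hp)).2
        simp [hx]
      · rintro t ⟨hmem, ht⟩
        obtain ⟨x, rfl⟩ := mem_Tdeg_one.1 ht
        have hx := (eq_zero_of_algebraMap_add_ι_mem_idl_range_mul (c := (0 : K)) (x := x)
          (by simpa using hmem)).2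
        simp [hx]
    | n + 2 =>
      rw [FTpred, inf_eq_left.2 (Tdeg_add_two_le_idl_sup_FT mul n),
        inf_eq_right.2 (Tdeg_add_two_le_idl_range_mul n)]

end
end

section
/- Let K be a field, D ≥ 1, and let q^{μν} ∈ K for μ,ν ∈ {1,…,D} satisfy q^{μν}q^{νμ} = 1 and q^{λλ} = 1. Let Λ_q be the quadratic algebra generated by D elements ω₁,…,ω_D of degree 1 with relations (ω_α)² = 0 for all α and ω_μω_ν + q^{νμ}ω_νω_μ = 0 for all μ,ν. Then: (1) the monomials ω_{i₁}ω_{i₂}⋯ω_{i_k} with i₁ < i₂ < ⋯ < i_k form a basis of Λ_q; (2) dim((Λ_q)_D) = 1 and the bilinear map (x,y) ↦ (xy)_D is nondegenerate, so Λ_q is a graded connected Frobenius algebra; (3) the graded automorphism σ of Λ_q satisfying xy = σ(y)x for x ∈ (Λ_q)ₙ, y ∈ (Λ_q)_{D−n} is given on generators by σ(ω_α) = (−1)^{D−1} (∏_{β≠α} q^{αβ}) ω_α. -/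
/-!
STATEMENT 15: Let `K` be a field, `D ≥ 1`, and `q^{μν} ∈ K` with `q^{μν}q^{νμ} = 1`,
`q^{λλ} = 1`.  Let `Λ_q` be the quadratic algebra on generators `ω₁,…,ω_D` with relations
`ω_α² = 0` and `ω_μω_ν + q^{νμ}ω_νω_μ = 0`.  Then:
(1) the monomials `ω_{i₁}⋯ω_{i_k}` with `i₁ < ⋯ < i_k` form a basis of `Λ_q`;
(2) `dim (Λ_q)_D = 1` and `(x,y) ↦ (xy)_D` is nondegenerate (so `Λ_q` is a graded
    connected Frobenius algebra);
(3) the graded automorphism `σ` with `xy = σ(y)x` for `x ∈ (Λ_q)ₙ`, `y ∈ (Λ_q)_{D−n}` is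
    given by `σ(ω_α) = (−1)^{D−1}(∏_{β≠α} q^{αβ}) ω_α`.

Encodings.  `Λ_q` is the `RingQuot` of the free algebra on `Fin D` by the relations; its
degree-`n` component `G n` is the image of the span of degree-`n` words; monomials are
indexed by `Finset (Fin D)` (sorted products).  `(xy)_D ≠ 0` is encoded as
`x*y ∉ ⊔_{n ≠ D} G n` (the component in the top degree `D` of an element of the graded
algebra is nonzero iff the element does not lie in the sum of the other homogeneous
components).
-/

noncomputable section

/-- The defining relations of `Λ_q`. -/
inductive relq (K : Type) [Field K] (D : ℕ) (q : Fin D → Fin D → K) :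
    FreeAlgebra K (Fin D) → FreeAlgebra K (Fin D) → Prop
  | sq (α : Fin D) : relq K D q (FreeAlgebra.ι K α * FreeAlgebra.ι K α) 0
  | comm (μ ν : Fin D) : relq K D q
      (FreeAlgebra.ι K μ * FreeAlgebra.ι K ν + q ν μ • (FreeAlgebra.ι K ν * FreeAlgebra.ι K μ)) 0

variable (K : Type) [Field K] (D : ℕ) (q : Fin D → Fin D → K)

/-- The quadratic algebra `Λ_q`. -/
abbrev Λq := RingQuot (relq K D q)

def mkΛ : FreeAlgebra K (Fin D) →ₐ[K] Λq K D q := RingQuot.mkAlgHom K (relq K D q)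

/-- The generators `ω_α` of `Λ_q`. -/
def gen (α : Fin D) : Λq K D q := mkΛ K D q (FreeAlgebra.ι K α)

/-- The degree-`n` homogeneous component of the free algebra (span of words of
length `n`). -/
def Fdeg (n : ℕ) : Submodule K (FreeAlgebra K (Fin D)) :=
  (Submodule.span K (Set.range (FreeAlgebra.ι K : Fin D → FreeAlgebra K (Fin D)))) ^ n

/-- The degree-`n` homogeneous component `(Λ_q)ₙ`. -/
def G (n : ℕ) : Submodule K (Λq K D q) :=
  Submodule.map (mkΛ K D q).toLinearMap (Fdeg K D n)

/-- The ordered monomial `ω_{i₁}ω_{i₂}⋯ω_{i_k}`, `i₁ < i₂ < ⋯ < i_k`, attached to a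
finite subset of `{1,…,D}`. -/
def mon (s : Finset (Fin D)) : Λq K D q := ((s.sort (· ≤ ·)).map (gen K D q)).prod

/-- The sum of all homogeneous components of degree `≠ D`; an element `z` has nonzero
component `(z)_D` in the top degree iff `z ∉ offTop`. -/
def offTop : Submodule K (Λq K D q) := ⨆ n ∈ {m : ℕ | m ≠ D}, G K D q n

section

variable {K D q}

/-- The scalar picked up when `ω_α` is moved from the left into its place in the ordered
monomial of `insert α s`. -/
def insertCoeff (q : Fin D → Fin D → K) (α : Fin D) (s : Finset (Fin D)) : K :=
  ∏ β ∈ s.filter (· < α), -q β α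

lemma insertCoeff_eq_one {α : Fin D} {s : Finset (Fin D)} (h : ∀ β ∈ s, α < β) :
    insertCoeff q α s = 1 := by
  rw [insertCoeff, Finset.filter_false_of_mem fun β hβ => (h β hβ).not_gt, Finset.prod_empty]

lemma insertCoeff_insert_of_lt {α β : Fin D} {s : Finset (Fin D)} (h : β < α) (hs : β ∉ s) :
    insertCoeff q α (insert β s) = -q β α * insertCoeff q α s := by
  rw [insertCoeff, Finset.filter_insert, if_pos h, Finset.prod_insert (by simp [hs])]
  rfl

lemma insertCoeff_insert_of_gt {α β : Fin D} {s : Finset (Fin D)} (h : α < β) :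
    insertCoeff q α (insert β s) = insertCoeff q α s := by
  rw [insertCoeff, Finset.filter_insert, if_neg h.not_gt]
  rfl

lemma insertCoeff_ne_zero (hq : ∀ μ ν, q μ ν * q ν μ = 1) (α : Fin D) (s : Finset (Fin D)) :
    insertCoeff q α s ≠ 0 :=
  Finset.prod_ne_zero_iff.2 fun β _ => neg_ne_zero.2 (left_ne_zero_of_mul_eq_one (hq β α))

/-- Left multiplication by `ω_α` on the free module over the ordered monomials. -/
def insertOp (q : Fin D → Fin D → K) (α : Fin D) : Module.End K (Finset (Fin D) →₀ K) :=
  Finsupp.linearCombination K fun s =>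
    if α ∈ s then 0 else insertCoeff q α s • Finsupp.single (insert α s) 1

lemma insertOp_single_of_mem {α : Fin D} {s : Finset (Fin D)} (h : α ∈ s) :
    insertOp q α (Finsupp.single s 1) = 0 := by
  simp [insertOp, h]

lemma insertOp_single_of_notMem {α : Fin D} {s : Finset (Fin D)} (h : α ∉ s) :
    insertOp q α (Finsupp.single s 1) =
      insertCoeff q α s • Finsupp.single (insert α s) 1 := by
  simp [insertOp, h]

lemma insertOp_mul_self (α : Fin D) : insertOp q α * insertOp q α = 0 := by
  refine Finsupp.lhom_ext' fun s => LinearMap.ext_ring ?_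
  by_cases h : α ∈ s
  · simp [insertOp_single_of_mem h]
  · simp [insertOp_single_of_notMem h, insertOp_single_of_mem, -Finsupp.smul_single]

lemma insertOp_comm (hq : ∀ μ ν, q μ ν * q ν μ = 1) (μ ν : Fin D) :
    insertOp q μ * insertOp q ν + q ν μ • (insertOp q ν * insertOp q μ) = 0 := by
  rcases eq_or_ne μ ν with rfl | hne
  · simp [insertOp_mul_self]
  refine Finsupp.lhom_ext' fun s => LinearMap.ext_ring ?_
  simp only [LinearMap.comp_apply, Finsupp.lsingle_apply, LinearMap.add_apply,
    LinearMap.smul_apply, Module.End.mul_apply, LinearMap.zero_apply]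
  by_cases hμ : μ ∈ s <;> by_cases hν : ν ∈ s
  · simp [insertOp_single_of_mem, hμ, hν]
  · simp [insertOp_single_of_mem, insertOp_single_of_notMem, hμ, hν, -Finsupp.smul_single]
  · simp [insertOp_single_of_mem, insertOp_single_of_notMem, hμ, hν, -Finsupp.smul_single]
  · have hμ' : μ ∉ insert ν s := by simp [hμ, hne]
    have hν' : ν ∉ insert μ s := by simp [hν, hne.symm]
    rw [insertOp_single_of_notMem hν, insertOp_single_of_notMem hμ, map_smul, map_smul,
      insertOp_single_of_notMem hν', insertOp_single_of_notMem hμ', Finset.insert_comm ν μ,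
      smul_smul, smul_smul, smul_smul, ← add_smul]
    convert zero_smul K _
    rcases hne.lt_or_gt with h | h
    · rw [insertCoeff_insert_of_gt h, insertCoeff_insert_of_lt h hμ]
      linear_combination (-insertCoeff q ν s * insertCoeff q μ s) * hq ν μ
    · rw [insertCoeff_insert_of_gt h, insertCoeff_insert_of_lt h hν]
      ring

/-- The action of `Λ_q` on the free module over the ordered monomials. -/
def insertRep (hq : ∀ μ ν, q μ ν * q ν μ = 1) :
    Λq K D q →ₐ[K] Module.End K (Finset (Fin D) →₀ K) :=
  RingQuot.liftAlgHom K ⟨FreeAlgebra.lift K (insertOp q), fun x y h => by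
    cases h with
    | sq α => simp [insertOp_mul_self]
    | comm μ ν => simp [insertOp_comm hq]⟩

lemma insertRep_gen (hq : ∀ μ ν, q μ ν * q ν μ = 1) (α : Fin D) :
    insertRep hq (gen K D q α) = insertOp q α := by
  simp [insertRep, gen, mkΛ]

lemma gen_mul_self (α : Fin D) : gen K D q α * gen K D q α = 0 := by
  simpa [gen, mkΛ] using RingQuot.mkAlgHom_rel K (relq.sq (q := q) α)

lemma gen_mul_gen (μ ν : Fin D) :
    gen K D q μ * gen K D q ν = -q ν μ • (gen K D q ν * gen K D q μ) := by
  have h : gen K D q μ * gen K D q ν + q ν μ • (gen K D q ν * gen K D q μ) = 0 := by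
    simpa [gen, mkΛ] using RingQuot.mkAlgHom_rel K (relq.comm (q := q) μ ν)
  refine add_right_cancel (h.trans ?_)
  rw [← add_smul, neg_add_cancel, zero_smul]

lemma mon_empty : mon K D q ∅ = 1 := by
  simp [mon]

lemma mon_insert {α : Fin D} {s : Finset (Fin D)} (h : ∀ β ∈ s, α < β) :
    mon K D q (insert α s) = gen K D q α * mon K D q s := by
  rw [mon, Finset.sort_insert _ (fun β hβ => (h β hβ).le) fun hα => (h α hα).false,
    List.map_cons, List.prod_cons, mon]

lemma mon_singleton (α : Fin D) : mon K D q {α} = gen K D q α := by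
  simp [mon]

lemma gen_mul_mon_of_mem {α : Fin D} {s : Finset (Fin D)} (hα : α ∈ s) :
    gen K D q α * mon K D q s = 0 := by
  induction s using Finset.induction_on_min with
  | empty => simp at hα
  | insert a s h ih =>
    rw [mon_insert h, ← mul_assoc]
    rcases Finset.mem_insert.1 hα with rfl | hα
    · rw [gen_mul_self, zero_mul]
    · rw [gen_mul_gen, smul_mul_assoc, mul_assoc, ih hα, mul_zero, smul_zero]

lemma gen_mul_mon_of_notMem {α : Fin D} {s : Finset (Fin D)} (hα : α ∉ s) :
    gen K D q α * mon K D q s = insertCoeff q α s • mon K D q (insert α s) := by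
  induction s using Finset.induction_on_min with
  | empty => rw [insertCoeff_eq_one (by simp), one_smul, mon_insert (by simp)]
  | insert a s h ih =>
    rw [Finset.mem_insert, not_or] at hα
    rcases lt_or_gt_of_ne hα.1 with hlt | hgt
    · have hmin : ∀ β ∈ insert a s, α < β := by
        simpa [hlt] using fun β hβ => hlt.trans (h β hβ)
      rw [insertCoeff_eq_one hmin, one_smul, mon_insert hmin]
    · have hmin : ∀ β ∈ insert α s, a < β := by simpa [hgt] using h
      rw [mon_insert h, ← mul_assoc, gen_mul_gen, smul_mul_assoc, mul_assoc, ih hα.2,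
        mul_smul_comm, smul_smul, ← mon_insert hmin,
        insertCoeff_insert_of_lt hgt fun ha => (h a ha).false, Finset.insert_comm]

lemma mon_mul_gen (α : Fin D) (s : Finset (Fin D)) :
    mon K D q s * gen K D q α = (∏ β ∈ s, -q α β) • (gen K D q α * mon K D q s) := by
  induction s using Finset.induction_on_min with
  | empty => simp [mon_empty]
  | insert a s h ih =>
    rw [mon_insert h, Finset.prod_insert fun ha => (h a ha).false, mul_assoc, ih,
      mul_smul_comm, ← mul_assoc, gen_mul_gen a α, smul_mul_assoc, smul_smul, mul_assoc, mul_comm]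

lemma mon_mul_mon_of_disjoint (hq : ∀ μ ν, q μ ν * q ν μ = 1) {s t : Finset (Fin D)}
    (hst : Disjoint s t) : ∃ d : K, d ≠ 0 ∧ mon K D q s * mon K D q t = d • mon K D q (s ∪ t) := by
  induction s using Finset.induction_on_min with
  | empty => exact ⟨1, one_ne_zero, by simp [mon_empty]⟩
  | insert a s h ih =>
    rw [Finset.disjoint_insert_left] at hst
    obtain ⟨d, hd, hmul⟩ := ih hst.2
    have ha : a ∉ s ∪ t := by
      rw [Finset.mem_union, not_or]
      exact ⟨fun ha => (h a ha).false, hst.1⟩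
    refine ⟨d * insertCoeff q a (s ∪ t), mul_ne_zero hd (insertCoeff_ne_zero hq _ _), ?_⟩
    rw [mon_insert h, mul_assoc, hmul, mul_smul_comm, gen_mul_mon_of_notMem ha, smul_smul,
      Finset.insert_union]

lemma mon_mul_mon_of_not_disjoint (hq : ∀ μ ν, q μ ν * q ν μ = 1) {s t : Finset (Fin D)}
    (hst : ¬Disjoint s t) : mon K D q s * mon K D q t = 0 := by
  induction s using Finset.induction_on_min with
  | empty => simp at hst
  | insert a s h ih =>
    rw [mon_insert h, mul_assoc]
    by_cases hs : Disjoint s t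
    · obtain ⟨d, -, hmul⟩ := mon_mul_mon_of_disjoint hq hs
      have ha : a ∈ t := by
        by_contra ha
        exact hst (Finset.disjoint_insert_left.2 ⟨ha, hs⟩)
      rw [hmul, mul_smul_comm, gen_mul_mon_of_mem (Finset.mem_union_right _ ha), smul_zero]
    · rw [ih hs, mul_zero]

lemma insertRep_mon (hq : ∀ μ ν, q μ ν * q ν μ = 1) (s : Finset (Fin D)) :
    insertRep hq (mon K D q s) (Finsupp.single ∅ 1) = Finsupp.single s 1 := by
  induction s using Finset.induction_on_min with
  | empty => simp [mon_empty]
  | insert a s h ih =>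
    rw [mon_insert h, map_mul, Module.End.mul_apply, ih, insertRep_gen,
      insertOp_single_of_notMem fun ha => (h a ha).false, insertCoeff_eq_one h, one_smul]

theorem linearIndependent_mon (hq : ∀ μ ν, q μ ν * q ν μ = 1) :
    LinearIndependent K (mon K D q) := by
  refine LinearIndependent.of_comp
    ((LinearMap.applyₗ (Finsupp.single ∅ 1)).comp (insertRep hq).toLinearMap) ?_
  convert (Finsupp.basisSingleOne (R := K) (ι := Finset (Fin D))).linearIndependent using 1
  ext1 s
  simpa using insertRep_mon hq s

lemma G_eq_pow (n : ℕ) : G K D q n = Submodule.span K (Set.range (gen K D q)) ^ n := by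
  rw [G, Fdeg, Submodule.map_pow, Submodule.map_span, ← Set.range_comp]
  rfl

theorem G_eq_span (n : ℕ) :
    G K D q n = Submodule.span K (mon K D q '' {s | s.card = n}) := by
  rw [G_eq_pow]
  apply le_antisymm
  · induction n with
    | zero =>
      rw [pow_zero, Submodule.one_eq_span, Submodule.span_le, Set.singleton_subset_iff]
      exact Submodule.subset_span ⟨∅, by simp, mon_empty⟩
    | succ n ih =>
      rw [pow_succ']
      refine (mul_le_mul_right ih _).trans ?_
      rw [Submodule.span_mul_span, Submodule.span_le]
      rintro _ ⟨_, ⟨α, rfl⟩, _, ⟨s, rfl, rfl⟩, rfl⟩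
      by_cases hα : α ∈ s
      · simp [gen_mul_mon_of_mem hα]
      · simp only [gen_mul_mon_of_notMem hα]
        exact Submodule.smul_mem _ _
          (Submodule.subset_span ⟨_, Finset.card_insert_of_notMem hα, rfl⟩)
  · rw [Submodule.span_le]
    rintro _ ⟨s, rfl, rfl⟩
    induction s using Finset.induction_on_min with
    | empty => simp [mon_empty, Submodule.one_le.1 le_rfl]
    | insert a s h ih =>
      rw [mon_insert h, Finset.card_insert_of_notMem fun ha => (h a ha).false, pow_succ']
      exact Submodule.mul_mem_mul (Submodule.subset_span ⟨a, rfl⟩) ih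

lemma mon_mem_G (s : Finset (Fin D)) :
    mon K D q s ∈ G K D q s.card :=
  (G_eq_span (q := q) s.card).ge <| Submodule.subset_span ⟨s, rfl, rfl⟩

theorem span_mon : Submodule.span K (Set.range (mon K D q)) = ⊤ := by
  have hmul : ∀ (x : FreeAlgebra K (Fin D)), ∀ y ∈ Submodule.span K (Set.range (mon K D q)),
      mkΛ K D q x * y ∈ Submodule.span K (Set.range (mon K D q)) := by
    intro x
    induction x using FreeAlgebra.induction with
    | grade0 r =>
      intro y hy
      rw [AlgHom.commutes, ← Algebra.smul_def]
      exact Submodule.smul_mem _ r hy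
    | grade1 α =>
      intro y hy
      induction hy using Submodule.span_induction with
      | mem y hy =>
        obtain ⟨s, rfl⟩ := hy
        change gen K D q α * _ ∈ _
        by_cases hα : α ∈ s
        · simp [gen_mul_mon_of_mem hα]
        · rw [gen_mul_mon_of_notMem hα]
          exact Submodule.smul_mem _ _ (Submodule.subset_span ⟨_, rfl⟩)
      | zero => simp
      | add y z _ _ hy hz => rw [mul_add]; exact add_mem hy hz
      | smul r y _ hy => rw [mul_smul_comm]; exact Submodule.smul_mem _ r hy
    | add x y hx hy =>
      intro z hz
      rw [map_add, add_mul]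
      exact add_mem (hx z hz) (hy z hz)
    | mul x y hx hy =>
      intro z hz
      rw [map_mul, mul_assoc]
      exact hx _ (hy z hz)
  refine eq_top_iff.2 fun x _ => ?_
  obtain ⟨x, rfl⟩ := RingQuot.mkAlgHom_surjective K (relq K D q) x
  simpa [mkΛ] using hmul x 1 (Submodule.subset_span ⟨∅, mon_empty⟩)

/-- The basis of ordered monomials of `Λ_q`. -/
def monBasis (hq : ∀ μ ν, q μ ν * q ν μ = 1) :
    Module.Basis (Finset (Fin D)) K (Λq K D q) :=
  Module.Basis.mk (linearIndependent_mon hq) span_mon.ge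

lemma monBasis_apply (hq : ∀ μ ν, q μ ν * q ν μ = 1) (s : Finset (Fin D)) :
    monBasis hq s = mon K D q s :=
  Module.Basis.mk_apply _ _ s

lemma monBasis_coord_mon (hq : ∀ μ ν, q μ ν * q ν μ = 1)
    (s t : Finset (Fin D)) :
    (monBasis hq).coord t (mon K D q s) = if s = t then 1 else 0 := by
  rw [← monBasis_apply hq, Module.Basis.coord_apply, Module.Basis.repr_self,
    Finsupp.single_apply]

lemma coord_univ_eq_zero_of_mem_offTop (hq : ∀ μ ν, q μ ν * q ν μ = 1) {x : Λq K D q}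
    (hx : x ∈ offTop K D q) :
    (monBasis hq).coord Finset.univ x = 0 := by
  suffices h : offTop K D q ≤ LinearMap.ker ((monBasis hq).coord Finset.univ) from h hx
  refine iSup₂_le fun n hn => ?_
  rw [G_eq_span, Submodule.span_le]
  rintro _ ⟨s, rfl, rfl⟩
  have hs : s ≠ Finset.univ := by
    rintro rfl
    simp at hn
  simpa [hs] using monBasis_coord_mon hq s Finset.univ

lemma exists_coord_univ_mul_mon_compl (hq : ∀ μ ν, q μ ν * q ν μ = 1) (s : Finset (Fin D)) :
    ∃ d : K, d ≠ 0 ∧ ∀ x, (monBasis hq).coord Finset.univ (x * mon K D q sᶜ) =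
      d * (monBasis hq).coord s x := by
  obtain ⟨d, hd, hmul⟩ := mon_mul_mon_of_disjoint hq (disjoint_compl_right (a := s))
  refine ⟨d, hd, fun x => ?_⟩
  suffices h : (monBasis hq).coord Finset.univ ∘ₗ LinearMap.mulRight K (mon K D q sᶜ) =
      d • (monBasis hq).coord s from LinearMap.congr_fun h x
  refine (monBasis hq).ext fun t => ?_
  simp only [LinearMap.comp_apply, LinearMap.mulRight_apply, LinearMap.smul_apply,
    monBasis_apply, monBasis_coord_mon, smul_eq_mul]
  split_ifs with hts
  · subst hts
    rw [hmul, map_smul, monBasis_coord_mon, if_pos (Finset.union_compl t), smul_eq_mul]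
  · by_cases hdis : Disjoint t sᶜ
    · obtain ⟨e, -, he⟩ := mon_mul_mon_of_disjoint hq hdis
      have hne : t ∪ sᶜ ≠ Finset.univ := fun h => hts <| by
        simpa using (IsCompl.of_eq (disjoint_iff.1 hdis) h).eq_compl
      rw [he, map_smul, monBasis_coord_mon, if_neg hne, smul_zero, mul_zero]
    · rw [mon_mul_mon_of_not_disjoint hq hdis, map_zero, mul_zero]

lemma exists_coord_univ_mon_compl_mul (hq : ∀ μ ν, q μ ν * q ν μ = 1) (s : Finset (Fin D)) :
    ∃ d : K, d ≠ 0 ∧ ∀ x, (monBasis hq).coord Finset.univ (mon K D q sᶜ * x) =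
      d * (monBasis hq).coord s x := by
  obtain ⟨d, hd, hmul⟩ := mon_mul_mon_of_disjoint hq (disjoint_compl_left (a := s))
  refine ⟨d, hd, fun x => ?_⟩
  suffices h : (monBasis hq).coord Finset.univ ∘ₗ LinearMap.mulLeft K (mon K D q sᶜ) =
      d • (monBasis hq).coord s from LinearMap.congr_fun h x
  refine (monBasis hq).ext fun t => ?_
  simp only [LinearMap.comp_apply, LinearMap.mulLeft_apply, LinearMap.smul_apply,
    monBasis_apply, monBasis_coord_mon, smul_eq_mul]
  split_ifs with hts
  · subst hts
    rw [hmul, map_smul, monBasis_coord_mon,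
      if_pos ((Finset.union_comm _ _).trans (Finset.union_compl t)), smul_eq_mul]
  · by_cases hdis : Disjoint sᶜ t
    · obtain ⟨e, -, he⟩ := mon_mul_mon_of_disjoint hq hdis
      have hne : sᶜ ∪ t ≠ Finset.univ := fun h => hts <| by
        simpa using (IsCompl.of_eq (disjoint_iff.1 hdis) h).compl_eq.symm
      rw [he, map_smul, monBasis_coord_mon, if_neg hne, smul_zero, mul_zero]
    · rw [mon_mul_mon_of_not_disjoint hq hdis, map_zero, mul_zero]

lemma exists_coord_ne_zero (hq : ∀ μ ν, q μ ν * q ν μ = 1)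
    {x : Λq K D q} (hx : x ≠ 0) : ∃ s, (monBasis hq).coord s x ≠ 0 := by
  contrapose! hx
  exact (monBasis hq).forall_coord_eq_zero_iff.1 hx

theorem finrank_G_top (hq : ∀ μ ν, q μ ν * q ν μ = 1) :
    Module.finrank K (G K D q D) = 1 := by
  have htop : {s : Finset (Fin D) | s.card = D} = {Finset.univ} := by
    ext s
    simpa using Finset.card_eq_iff_eq_univ s
  rw [G_eq_span, htop, Set.image_singleton]
  exact finrank_span_singleton ((linearIndependent_mon hq).ne_zero _)

/-- An element of degree one which is annihilated on the right by all monomials of degree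
`D - 1` vanishes. -/
lemma eq_zero_of_mul_mon_erase_eq_zero (hq : ∀ μ ν, q μ ν * q ν μ = 1) {z : Λq K D q}
    (hz : z ∈ G K D q 1)
    (h : ∀ β, z * mon K D q (Finset.univ.erase β) = 0) : z = 0 := by
  rw [G_eq_pow, pow_one, Submodule.mem_span_range_iff_exists_fun] at hz
  obtain ⟨c, rfl⟩ := hz
  refine Finset.sum_eq_zero fun β _ => ?_
  have hβ := h β
  rw [Finset.sum_mul, Finset.sum_eq_single β
    (fun γ _ hγ => by rw [smul_mul_assoc, gen_mul_mon_of_mem (by simp [hγ]), smul_zero])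
    (by simp), smul_mul_assoc, gen_mul_mon_of_notMem (by simp), smul_smul] at hβ
  have := (smul_eq_zero.1 hβ).resolve_right ((linearIndependent_mon hq).ne_zero _)
  rw [(mul_eq_zero.1 this).resolve_right (insertCoeff_ne_zero hq _ _), zero_smul]

end

theorem stmt_15
    (hD : 1 ≤ D)
    (hq : ∀ μ ν, q μ ν * q ν μ = 1)
    (hqdiag : ∀ l, q l l = 1) :
    -- (1) the ordered monomials form a basis of `Λ_q`
    (LinearIndependent K (mon K D q) ∧
      Submodule.span K (Set.range (mon K D q)) = ⊤) ∧
    -- (2) `dim (Λ_q)_D = 1` and `(x,y) ↦ (xy)_D` is nondegenerate: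
    --     `Λ_q` is a graded connected Frobenius algebra
    (Module.finrank K ↥(G K D q D) = 1 ∧
      (∀ x : Λq K D q, x ≠ 0 → ∃ y, x * y ∉ offTop K D q) ∧
      (∀ y : Λq K D q, y ≠ 0 → ∃ x, x * y ∉ offTop K D q)) ∧
    -- (3) the graded automorphism `σ` with `xy = σ(y)x` (`x ∈ (Λ_q)ₙ`, `y ∈ (Λ_q)_{D−n}`)
    --     satisfies `σ(ω_α) = (−1)^{D−1}(∏_{β≠α} q^{αβ}) ω_α`
    (∀ σ : Λq K D q ≃ₐ[K] Λq K D q,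
      (∀ n : ℕ, ∀ x ∈ G K D q n, σ x ∈ G K D q n) →
      (∀ n : ℕ, n ≤ D → ∀ x ∈ G K D q n, ∀ y ∈ G K D q (D - n), x * y = σ y * x) →
      ∀ α : Fin D,
        σ (gen K D q α) =
          ((-1 : K) ^ (D - 1) * ∏ β ∈ Finset.univ.erase α, q α β) • gen K D q α) := by
  refine ⟨⟨linearIndependent_mon hq, span_mon⟩, ⟨finrank_G_top hq, ?_, ?_⟩, ?_⟩
  · intro x hx
    obtain ⟨s, hs⟩ := exists_coord_ne_zero hq hx
    obtain ⟨d, hd, hmul⟩ := exists_coord_univ_mul_mon_compl hq s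
    refine ⟨mon K D q sᶜ, fun hmem => mul_ne_zero hd hs ?_⟩
    rw [← hmul, coord_univ_eq_zero_of_mem_offTop hq hmem]
  · intro x hx
    obtain ⟨s, hs⟩ := exists_coord_ne_zero hq hx
    obtain ⟨d, hd, hmul⟩ := exists_coord_univ_mon_compl_mul hq s
    refine ⟨mon K D q sᶜ, fun hmem => mul_ne_zero hd hs ?_⟩
    rw [← hmul, coord_univ_eq_zero_of_mem_offTop hq hmem]
  · intro σ hσ hcomm α
    have hgen : gen K D q α ∈ G K D q 1 := by
      simpa [mon_singleton] using mon_mem_G ({α} : Finset (Fin D))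
    have hmul : ∀ β, σ (gen K D q α) * mon K D q (Finset.univ.erase β) =
        (∏ γ ∈ Finset.univ.erase β, -q α γ) •
          (gen K D q α * mon K D q (Finset.univ.erase β)) := by
      intro β
      rw [← mon_mul_gen]
      refine (hcomm (D - 1) (Nat.sub_le _ _) _ ?_ _ ?_).symm
      · simpa using mon_mem_G (Finset.univ.erase β)
      · rwa [Nat.sub_sub_self hD]
    rw [← sub_eq_zero]
    refine eq_zero_of_mul_mon_erase_eq_zero hq
      (sub_mem (hσ 1 _ hgen) (Submodule.smul_mem _ _ hgen)) fun β => ?_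
    rw [sub_mul, hmul, smul_mul_assoc, sub_eq_zero]
    rcases eq_or_ne α β with rfl | hne
    · rw [Finset.prod_neg]
      simp
    · rw [gen_mul_mon_of_mem (by simp [hne]), smul_zero, smul_zero]

end
end

section
/- Let K be a field of characteristic 0 and W a finite-dimensional K-vector space. If D: W → S²(W) is a linear map into the degree-2 component of the symmetric algebra S(W) such that D(α)·β = D(β)·α in S³(W) for all α,β ∈ W, then there exists θ ∈ W such that D(α) = θ·α for all α ∈ W (products taken in S(W)). -/
/-!
STATEMENT 18: Let `K` be a field of characteristic 0 and `W` a finite-dimensional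
`K`-vector space.  If `D : W → S²(W)` is a linear map into the degree-2 component of the
symmetric algebra `S(W)` such that `D(α)·β = D(β)·α` in `S³(W)` for all `α, β ∈ W`, then
there exists `θ ∈ W` with `D(α) = θ·α` for all `α ∈ W`.

The symmetric algebra is realized as the quotient of the tensor algebra `T(W)` by the
commutation relations `x⊗y = y⊗x` (via `RingQuot`), with `Sⁿ(W)` the image of the
degree-`n` component of `T(W)`.
-/

noncomputable section

open TensorAlgebra

variable (K W : Type) [Field K] [AddCommGroup W] [Module K W]

/-- Commutation relations defining the symmetric algebra. -/
def relS : TensorAlgebra K W → TensorAlgebra K W → Prop := fun a b =>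
  ∃ x y : W, a = TensorAlgebra.ι K x * TensorAlgebra.ι K y ∧
    b = TensorAlgebra.ι K y * TensorAlgebra.ι K x

/-- The symmetric algebra `S(W) = T(W)/(x⊗y − y⊗x)`. -/
abbrev SymA := RingQuot (relS K W)

def mkS : TensorAlgebra K W →ₐ[K] SymA K W := RingQuot.mkAlgHom K (relS K W)

/-- The canonical inclusion `W → S(W)`. -/
def σW : W →ₗ[K] SymA K W := (mkS K W).toLinearMap ∘ₗ TensorAlgebra.ι K

/-- The degree-`n` component `Sⁿ(W)` of the symmetric algebra. -/
def SymDeg (n : ℕ) : Submodule K (SymA K W) :=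
  Submodule.map (mkS K W).toLinearMap (LinearMap.range (TensorAlgebra.ι K : W →ₗ[K] _) ^ n)

variable {K W}

lemma MvPolynomial.IsHomogeneous.of_X_mul {R τ : Type*} [CommSemiring R] {i : τ} {n : ℕ}
    {q : MvPolynomial τ R} (h : (MvPolynomial.X i * q).IsHomogeneous (n + 1)) :
    q.IsHomogeneous n := by
  intro d hd
  have hw := h (d := Finsupp.single i 1 + d) (by rwa [MvPolynomial.coeff_X_mul])
  rw [map_add, Finsupp.weight_single] at hw
  simp only [Pi.one_apply, smul_eq_mul, mul_one] at hw
  omega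

lemma MvPolynomial.IsHomogeneous.X_dvd_of_subsingleton {R τ : Type*} [CommSemiring R]
    [Subsingleton τ] {n : ℕ} {p : MvPolynomial τ R} (hp : p.IsHomogeneous n) (hn : n ≠ 0)
    (i : τ) : MvPolynomial.X i ∣ p := by
  rw [p.as_sum]
  refine Finset.dvd_sum fun d hd => MvPolynomial.X_dvd_monomial.mpr (Or.inr fun hdi => hn ?_)
  have hd0 : d = 0 := Finsupp.ext fun j => by rw [Subsingleton.elim j i, hdi]; rfl
  rw [← hp (MvPolynomial.mem_support_iff.mp hd), hd0, map_zero]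

/-- A family of quadratic forms `p i` with `p i * X j = p j * X i` is the product of a single
linear form with the variables. -/
lemma MvPolynomial.exists_eq_mul_X_of_mul_X_comm {R τ : Type*} [CommRing R] [IsDomain R]
    {n : ℕ} (p : τ → MvPolynomial τ R) (hp : ∀ i, (p i).IsHomogeneous (n + 1))
    (hcomm : ∀ i j, p i * MvPolynomial.X j = p j * MvPolynomial.X i) :
    ∃ q : MvPolynomial τ R, q.IsHomogeneous n ∧ ∀ i, p i = q * MvPolynomial.X i := by
  rcases isEmpty_or_nonempty τ with _ | ⟨⟨i⟩⟩
  · exact ⟨0, MvPolynomial.isHomogeneous_zero _ _ _, isEmptyElim⟩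
  have hdvd : MvPolynomial.X i ∣ p i := by
    rcases subsingleton_or_nontrivial τ with _ | _
    · exact (hp i).X_dvd_of_subsingleton n.succ_ne_zero i
    obtain ⟨j, hj⟩ := exists_ne i
    have h : MvPolynomial.X i ∣ p i * MvPolynomial.X j := hcomm i j ▸ dvd_mul_left _ _
    exact (MvPolynomial.X_dvd_mul_iff.mp h).resolve_right
      fun hij => hj (MvPolynomial.X_dvd_X.mp hij).symm
  obtain ⟨q, hq⟩ := hdvd
  refine ⟨q, .of_X_mul (hq ▸ hp i), fun j => ?_⟩
  refine mul_right_cancel₀ (MvPolynomial.X_ne_zero (R := R) i) ?_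
  rw [← hcomm i j, hq]
  ring

lemma mkS_surjective : Function.Surjective (mkS K W) := RingQuot.mkAlgHom_surjective K _

lemma σW_apply (x : W) : σW K W x = mkS K W (TensorAlgebra.ι K x) := rfl

lemma SymA.mul_comm (a b : SymA K W) : a * b = b * a := by
  obtain ⟨a, rfl⟩ := mkS_surjective a
  obtain ⟨b, rfl⟩ := mkS_surjective b
  change Commute _ _
  induction b using TensorAlgebra.induction with
  | algebraMap r => rw [AlgHom.commutes]; exact Algebra.commute_algebraMap_right _ _
  | ι x =>
    induction a using TensorAlgebra.induction with
    | algebraMap r => rw [AlgHom.commutes]; exact Algebra.commute_algebraMap_left _ _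
    | ι y =>
      have h : relS K W _ _ := ⟨y, x, rfl, rfl⟩
      simpa only [map_mul] using! RingQuot.mkAlgHom_rel K h
    | mul a b ha hb => rw [map_mul]; exact ha.mul_left hb
    | add a b ha hb => rw [map_add]; exact ha.add_left hb
  | mul b c hb hc => rw [map_mul]; exact hb.mul_right hc
  | add b c hb hc => rw [map_add]; exact hb.add_right hc

instance : CommRing (SymA K W) where
  __ := (inferInstance : Ring (SymA K W))
  mul_comm := SymA.mul_comm

/-- The algebra map `S(W) → A` into a commutative algebra extending a linear map `W → A`. -/
def SymA.lift {A : Type*} [CommRing A] [Algebra K A] (f : W →ₗ[K] A) : SymA K W →ₐ[K] A :=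
  RingQuot.liftAlgHom K ⟨TensorAlgebra.lift K f, by
    rintro _ _ ⟨x, y, rfl, rfl⟩
    simp [_root_.mul_comm]⟩

lemma SymA.lift_σW {A : Type*} [CommRing A] [Algebra K A] (f : W →ₗ[K] A) (x : W) :
    SymA.lift f (σW K W x) = f x := by
  rw [σW_apply, SymA.lift, mkS, RingQuot.liftAlgHom_mkAlgHom_apply, TensorAlgebra.lift_ι_apply]

/-- The algebra map `S(W) → K[X_i]` sending the basis vector `b i` to `X_i`. -/
def SymA.toMvPolynomial {τ : Type*} (b : Module.Basis τ K W) : SymA K W →ₐ[K] MvPolynomial τ K :=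
  SymA.lift (b.constr K MvPolynomial.X)

lemma SymA.toMvPolynomial_σW_basis {τ : Type*} (b : Module.Basis τ K W) (i : τ) :
    SymA.toMvPolynomial b (σW K W (b i)) = MvPolynomial.X i := by
  rw [SymA.toMvPolynomial, SymA.lift_σW, Module.Basis.constr_basis]

lemma SymA.toMvPolynomial_injective {τ : Type*} (b : Module.Basis τ K W) :
    Function.Injective (SymA.toMvPolynomial b) := by
  have hinv : ((MvPolynomial.aeval fun i => σW K W (b i)).comp (SymA.toMvPolynomial b)).comp
      (mkS K W) = mkS K W := by
    refine TensorAlgebra.hom_ext (b.ext fun i => ?_)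
    change MvPolynomial.aeval (fun i => σW K W (b i))
      (SymA.toMvPolynomial b (σW K W (b i))) = σW K W (b i)
    rw [SymA.toMvPolynomial_σW_basis, MvPolynomial.aeval_X]
  refine Function.LeftInverse.injective (g := MvPolynomial.aeval fun i => σW K W (b i))
    fun x => ?_
  obtain ⟨x, rfl⟩ := mkS_surjective x
  exact DFunLike.congr_fun hinv x

lemma SymA.map_range_σW {τ : Type*} (b : Module.Basis τ K W) :
    (LinearMap.range (σW K W)).map (SymA.toMvPolynomial b).toLinearMap =
      MvPolynomial.homogeneousSubmodule τ K 1 := by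
  rw [MvPolynomial.homogeneousSubmodule_one_eq_span_X, LinearMap.range_eq_map, ← b.span_eq,
    Submodule.map_span, Submodule.map_span, ← Set.range_comp, ← Set.range_comp]
  congr 2
  exact funext fun i => SymA.toMvPolynomial_σW_basis b i

lemma SymDeg_eq_range_pow (n : ℕ) : SymDeg K W n = LinearMap.range (σW K W) ^ n := by
  rw [SymDeg, Submodule.map_pow, σW, LinearMap.range_comp]

lemma SymA.isHomogeneous_toMvPolynomial {τ : Type*} (b : Module.Basis τ K W) {n : ℕ}
    {x : SymA K W} (hx : x ∈ SymDeg K W n) : (SymA.toMvPolynomial b x).IsHomogeneous n := by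
  have h := Submodule.mem_map_of_mem (f := (SymA.toMvPolynomial b).toLinearMap) hx
  rwa [SymDeg_eq_range_pow, Submodule.map_pow, SymA.map_range_σW,
    MvPolynomial.homogeneousSubmodule_one_pow] at h

variable (K W)

theorem stmt_18 [CharZero K] [FiniteDimensional K W]
    (D : W →ₗ[K] SymA K W)
    (hD2 : ∀ α : W, D α ∈ SymDeg K W 2)        -- `D` maps `W` into `S²(W)`
    (hsym : ∀ α β : W, D α * σW K W β = D β * σW K W α) :  -- `D(α)·β = D(β)·α` in `S³(W)`
    ∃ θ : W, ∀ α : W, D α = σW K W θ * σW K W α := by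
  let b := Module.Free.chooseBasis K W
  obtain ⟨q, hq, hDq⟩ := MvPolynomial.exists_eq_mul_X_of_mul_X_comm
    (fun i => SymA.toMvPolynomial b (D (b i)))
    (fun i => SymA.isHomogeneous_toMvPolynomial b (hD2 (b i)))
    (fun i j => by
      simpa only [map_mul, SymA.toMvPolynomial_σW_basis] using
        congrArg (SymA.toMvPolynomial b) (hsym (b i) (b j)))
  rw [← MvPolynomial.mem_homogeneousSubmodule, ← SymA.map_range_σW b] at hq
  obtain ⟨_, ⟨θ, rfl⟩, rfl⟩ := hq
  refine ⟨θ, fun α => ?_⟩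
  have hD : D = LinearMap.mulLeft K (σW K W θ) ∘ₗ σW K W := by
    refine b.ext fun i => SymA.toMvPolynomial_injective b ?_
    simpa only [LinearMap.comp_apply, LinearMap.mulLeft_apply, map_mul,
      SymA.toMvPolynomial_σW_basis, AlgHom.toLinearMap_apply] using hDq i
  exact DFunLike.congr_fun hD α

end
end
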